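/- Let (S, f) and (T, g) be lifted partial permutations on k letters with T = f(S). If cross(g∘f) = cross(f) + cross(g), then for every i ∈ {1, …, m} the difference w_i(S, f) + w_i(T, g) − w_i(S, g∘f) is a non-negative integer. -/

import Mathlib

open scoped Classical BigOperators

noncomputable section

/-- The group `G_m` of bijections of `ℤ` generated by the reflections
`x ↦ 1 - x` (about `1/2`) and `x ↦ 2m - 1 - x` (about `m - 1/2`). -/
def Gm (m : ℕ) : Subgroup (Equiv.Perm ℤ) :=
  Subgroup.closure {Equiv.subLeft (1 : ℤ), Equiv.subLeft (2 * (m : ℤ) - 1)}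

/-- `y` lies in the `G_m`-orbit of `x`. -/
def GmRel (m : ℕ) (x y : ℤ) : Prop := ∃ g ∈ Gm m, g x = y

/-- The `G_m`-orbit of an integer. -/
def GmOrbit (m : ℕ) (x : ℤ) : Set ℤ := {y | GmRel m x y}

/-- `(S, f)` is a lifted partial permutation on `k` letters: `S` is a
`G_m`-invariant subset of `ℤ`, `f` is `G_m`-equivariant on `S`, the quotient
`S/G_m` has exactly `k` elements, and the induced map `S/G_m → ℤ/G_m` is
injective.  (The values of `f` off `S` are irrelevant.) -/
structure IsLPP (m k : ℕ) (S : Set ℤ) (f : ℤ → ℤ) : Prop where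
  invariant : ∀ g ∈ Gm m, ∀ x ∈ S, g x ∈ S
  equivariant : ∀ g ∈ Gm m, ∀ x ∈ S, f (g x) = g (f x)
  orbits : (GmOrbit m '' S).ncard = k
  inj : ∀ x ∈ S, ∀ y ∈ S, GmRel m (f x) (f y) → GmRel m x y

/-- `(i, j)` is a crossing pair for `(S, f)`. -/
def IsCrossing (S : Set ℤ) (f : ℤ → ℤ) (i j : ℤ) : Prop :=
  i ∈ S ∧ j ∈ S ∧ i < j ∧ f j < f i

/-- The `G_m`-orbit of the unordered pair `{p.1, p.2}`; two pairs are
equivalent exactly when they have the same `pairOrbit`. -/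
def pairOrbit (m : ℕ) (p : ℤ × ℤ) : Set (Set ℤ) :=
  {A | ∃ g ∈ Gm m, A = {g p.1, g p.2}}

/-- The set of crossings of `(S, f)` (equivalence classes of crossing pairs). -/
def crossings (m : ℕ) (S : Set ℤ) (f : ℤ → ℤ) : Set (Set (Set ℤ)) :=
  pairOrbit m '' {p : ℤ × ℤ | IsCrossing S f p.1 p.2}

/-- The number of crossings `cross(f)`. -/
def crossCount (m : ℕ) (S : Set ℤ) (f : ℤ → ℤ) : ℕ := (crossings m S f).ncard

/-- The set whose cardinality (halved) is the weight `w_j(S, f)`. -/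
def weightSet (j : ℤ) (S : Set ℤ) (f : ℤ → ℤ) : Set ℤ :=
  {i | i ∈ S ∧ (((i : ℚ) < (j : ℚ) - 1/2 ∧ (j : ℚ) - 1/2 < (f i : ℚ)) ∨
    ((f i : ℚ) < (j : ℚ) - 1/2 ∧ (j : ℚ) - 1/2 < (i : ℚ)))}

/-- The weight `w_j(S, f)`. -/
def weight (j : ℤ) (S : Set ℤ) (f : ℤ → ℤ) : ℚ := (weightSet j S f).ncard / 2

/-- The resolution `f_{⟨i,j⟩}` of `f` at the crossing `⟨i, j⟩`. -/
def resolveFun (m : ℕ) (f : ℤ → ℤ) (i j : ℤ) : ℤ → ℤ := fun x =>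
  if h : ∃ g ∈ Gm m, g i = x then h.choose (f j)
  else if h' : ∃ g ∈ Gm m, g j = x then h'.choose (f i)
  else f x

/-- The graph `Γ_f = {(i, f i) : i ∈ S}`. -/
def graphOf (S : Set ℤ) (f : ℤ → ℤ) : Set (ℤ × ℤ) :=
  {p | p.1 ∈ S ∧ p.2 = f p.1}

/-- The `G_m`-orbit of a point of `ℤ × ℤ` under the diagonal action. -/
def GmOrbit2 (m : ℕ) (p : ℤ × ℤ) : Set (ℤ × ℤ) :=
  {q | ∃ g ∈ Gm m, (g p.1, g p.2) = q}

/-- The left endpoint of the image of the unit interval `[a, a+1]` under the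
affine extension of `g` to `ℝ`. -/
def sqIdx (g : Equiv.Perm ℤ) (a : ℤ) : ℤ := min (g a) (g (a + 1))

/-- The `G_m`-orbit of it the unit square indexed by `p`. -/
def sqOrbit (m : ℕ) (p : ℤ × ℤ) : Set (ℤ × ℤ) :=
  {q | ∃ g ∈ Gm m, (sqIdx g p.1, sqIdx g p.2) = q}

/-- `D` is a domain from `(S, f)` to `(T, g)`: a `G_m`-invariant assignment of
multiplicities to unit squares, nonzero on finitely many `G_m`-orbits of
squares, whose corners are governed by the two graphs. -/
def IsHDomain (m : ℕ) (S : Set ℤ) (f : ℤ → ℤ) (T : Set ℤ) (g : ℤ → ℤ)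
    (D : ℤ × ℤ → ℤ) : Prop :=
  (∀ γ ∈ Gm m, ∀ a b : ℤ, D (sqIdx γ a, sqIdx γ b) = D (a, b)) ∧
  (sqOrbit m '' {p : ℤ × ℤ | D p ≠ 0}).Finite ∧
  (∀ i j : ℤ,
    D (i, j) + D (i - 1, j - 1) - D (i, j - 1) - D (i - 1, j) =
      (if (i, j) ∈ graphOf T g then 1 else 0) -
        (if (i, j) ∈ graphOf S f then 1 else 0))


theorem Gm_apply_form {m : ℕ} {γ : Equiv.Perm ℤ} (hγ : γ ∈ Gm m) :
    ∃ n : ℤ, (∀ x, γ x = x + 2 * ((m - 1) * n)) ∨ ∀ x, γ x = 1 - x + 2 * ((m - 1) * n) := by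
  unfold Gm at hγ
  induction hγ using Subgroup.closure_induction with
  | mem γ h =>
    rcases h with rfl | rfl
    · exact ⟨0, Or.inr fun x => by simp⟩
    · exact ⟨1, Or.inr fun x => by simp only [Equiv.subLeft_apply]; ring⟩
  | one => exact ⟨0, Or.inl fun x => by simp⟩
  | mul a b _ _ ha hb =>
    obtain ⟨p, hp | hp⟩ := ha <;> obtain ⟨q, hq | hq⟩ := hb
    · exact ⟨p + q, Or.inl fun x => by rw [Equiv.Perm.mul_apply, hp, hq]; ring⟩
    · exact ⟨p + q, Or.inr fun x => by rw [Equiv.Perm.mul_apply, hp, hq]; ring⟩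
    · exact ⟨p - q, Or.inr fun x => by rw [Equiv.Perm.mul_apply, hp, hq]; ring⟩
    · exact ⟨p - q, Or.inl fun x => by rw [Equiv.Perm.mul_apply, hp, hq]; ring⟩
  | inv a _ ha =>
    obtain ⟨p, hp | hp⟩ := ha
    · exact ⟨-p, Or.inl fun x => by rw [Equiv.Perm.inv_eq_iff_eq, hp]; ring⟩
    · exact ⟨p, Or.inr fun x => by rw [Equiv.Perm.inv_eq_iff_eq, hp]; ring⟩

/-- `G_m` acts freely on `ℤ`. -/
theorem Gm_free {m : ℕ} {γ : Equiv.Perm ℤ} (hγ : γ ∈ Gm m) {x : ℤ} (hx : γ x = x) (y : ℤ) :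
    γ y = y := by
  obtain ⟨n, h | h⟩ := Gm_apply_form hγ
  · rw [h] at hx ⊢
    omega
  · rw [h] at hx
    omega

theorem addRight_mem_Gm (m : ℕ) (n : ℤ) : Equiv.addRight ((2 * m - 2) * n) ∈ Gm m := by
  have h : Equiv.subLeft (2 * (m : ℤ) - 1) * Equiv.subLeft (1 : ℤ) ∈ Gm m :=
    mul_mem (Subgroup.subset_closure (by simp)) (Subgroup.subset_closure (by simp))
  have e : Equiv.subLeft (2 * (m : ℤ) - 1) * Equiv.subLeft (1 : ℤ)
      = Equiv.addRight (2 * (m : ℤ) - 2) := by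
    ext x
    simp only [Equiv.Perm.mul_apply, Equiv.subLeft_apply, Equiv.coe_addRight]
    ring
  rw [e] at h
  induction n using Int.induction_on with
  | zero =>
    convert one_mem (Gm m) using 1
    ext x
    simp
  | succ p ih =>
    convert mul_mem ih h using 1
    ext x
    simp only [Equiv.Perm.mul_apply, Equiv.coe_addRight]
    ring
  | pred p ih =>
    convert mul_mem ih (inv_mem h) using 1
    ext x
    rw [eq_comm, Equiv.Perm.mul_apply, Equiv.Perm.inv_def, Equiv.addRight_symm]
    simp only [Equiv.coe_addRight]
    ring

namespace IsLPP

variable {m k : ℕ} {S : Set ℤ} {f : ℤ → ℤ}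

theorem injOn (hf : IsLPP m k S f) : Set.InjOn f S := by
  intro x hx y hy hxy
  obtain ⟨γ, hγ, rfl⟩ := hf.inj x hx y hy ⟨1, one_mem _, hxy⟩
  rw [hf.equivariant γ hγ x hx] at hxy
  exact (Gm_free hγ hxy.symm x).symm

theorem exists_displacement_bound (hf : IsLPP m k S f) (hm : 2 ≤ m) :
    ∃ B : ℤ, ∀ x ∈ S, |f x - x| ≤ B := by
  obtain ⟨B, hB⟩ := ((Finset.Ico (0 : ℤ) (2 * m - 2)).image fun r => |f r - r|).bddAbove
  refine ⟨B, fun x hx => ?_⟩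
  have hL : (0 : ℤ) < 2 * m - 2 := by omega
  have hmem := addRight_mem_Gm m (-(x / (2 * m - 2)))
  have hr : x % (2 * m - 2) = Equiv.addRight ((2 * (m : ℤ) - 2) * -(x / (2 * m - 2))) x := by
    rw [Equiv.coe_addRight, Int.emod_def]
    ring
  have hfr : f (x % (2 * m - 2)) - x % (2 * m - 2) = f x - x := by
    rw [hr, hf.equivariant _ hmem x hx, Equiv.coe_addRight]
    ring
  rw [← hfr]
  exact hB (Finset.mem_coe.2 (Finset.mem_image_of_mem (fun r => |f r - r|)
    (Finset.mem_Ico.2 ⟨Int.emod_nonneg _ hL.ne', Int.emod_lt_of_pos _ hL⟩)))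

end IsLPP

theorem mem_weightSet_iff {j : ℤ} {S : Set ℤ} {f : ℤ → ℤ} {x : ℤ} :
    x ∈ weightSet j S f ↔ x ∈ S ∧ ((x < j ∧ j ≤ f x) ∨ (f x < j ∧ j ≤ x)) := by
  have lt_half (a : ℤ) : (a : ℚ) < (j : ℚ) - 1 / 2 ↔ a < j := by
    refine ⟨fun h => by exact_mod_cast (by linarith : (a : ℚ) < j), fun h => ?_⟩
    have : (a : ℚ) + 1 ≤ j := by exact_mod_cast h
    linarith
  have half_lt (a : ℤ) : (j : ℚ) - 1 / 2 < a ↔ j ≤ a := by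
    refine ⟨fun h => ?_, fun h => ?_⟩
    · have : (j : ℚ) < a + 1 := by linarith
      exact Int.lt_add_one_iff.1 (by exact_mod_cast this)
    · have : (j : ℚ) ≤ a := by exact_mod_cast h
      linarith
  simp only [weightSet, Set.mem_ofPred_eq, lt_half, half_lt]

theorem IsLPP.finite_weightSet {m k : ℕ} {S : Set ℤ} {f : ℤ → ℤ} (hf : IsLPP m k S f)
    (hm : 2 ≤ m) (j : ℤ) : (weightSet j S f).Finite := by
  obtain ⟨B, hB⟩ := hf.exists_displacement_bound hm
  refine (Set.finite_Icc (j - B) (j + B)).subset fun x hx => ?_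
  rw [mem_weightSet_iff] at hx
  have := abs_le.1 (hB x hx.1)
  rw [Set.mem_Icc]
  omega

theorem ncard_add_ncard_eq_symmDiff {α : Type*} {A B : Set α} (hA : A.Finite) (hB : B.Finite) :
    A.ncard + B.ncard = (symmDiff A B).ncard + 2 * (A ∩ B).ncard := by
  have h₁ := Set.ncard_inter_add_ncard_sdiff_eq_ncard A B hA
  have h₂ := Set.ncard_inter_add_ncard_sdiff_eq_ncard B A hB
  have h₃ : (symmDiff A B).ncard = (A \ B).ncard + (B \ A).ncard :=
    Set.ncard_union_eq disjoint_sdiff_sdiff hA.sdiff hB.sdiff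
  rw [Set.inter_comm] at h₂
  omega

/-- The points `x ∈ S` for which `f x` and `g (f x)` lie on different sides of `j - 1/2` are
those separated by exactly one of `f` and `g ∘ f`. -/
theorem weightSet_image_eq (j : ℤ) (S : Set ℤ) (f g : ℤ → ℤ) :
    weightSet j (f '' S) g = f '' symmDiff (weightSet j S f) (weightSet j S (g ∘ f)) := by
  have key (x : ℤ) : x ∈ symmDiff (weightSet j S f) (weightSet j S (g ∘ f)) ↔
      x ∈ S ∧ ((f x < j ∧ j ≤ g (f x)) ∨ (g (f x) < j ∧ j ≤ f x)) := by
    simp only [Set.mem_symmDiff, mem_weightSet_iff, Function.comp_apply]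
    by_cases hx : x ∈ S <;> simp only [hx, true_and, false_and]
    · omega
    · simp
  ext y
  simp only [mem_weightSet_iff, Set.mem_image, key]
  constructor
  · rintro ⟨⟨x, hx, rfl⟩, h⟩
    exact ⟨x, ⟨hx, h⟩, rfl⟩
  · rintro ⟨x, ⟨hx, h⟩, rfl⟩
    exact ⟨⟨x, hx, rfl⟩, h⟩

/-- Weights of lifted partial permutations satisfy the triangle inequality, with integral
defect. -/
theorem IsLPP.weight_add_weight_eq {m k l : ℕ} {S : Set ℤ} {f g : ℤ → ℤ} (hm : 2 ≤ m)
    (hf : IsLPP m k S f) (hg : IsLPP m l (f '' S) g) (j : ℤ) :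
    ∃ n : ℕ, weight j S f + weight j (f '' S) g - weight j S (g ∘ f) = n := by
  set A := weightSet j S f with hA
  set C := weightSet j S (g ∘ f) with hC
  have hinj : Set.InjOn f (symmDiff A C) := hf.injOn.mono fun x hx => by
    rcases hx with h | h <;> exact h.1.1
  have himg : weightSet j (f '' S) g = f '' symmDiff A C := weightSet_image_eq j S f g
  have hAfin : A.Finite := hf.finite_weightSet hm j
  have hDfin : (symmDiff A C).Finite :=
    Set.Finite.of_finite_image (himg ▸ hg.finite_weightSet hm j) hinj
  have hcard := ncard_add_ncard_eq_symmDiff hAfin hDfin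
  rw [symmDiff_symmDiff_cancel_left] at hcard
  refine ⟨(A ∩ symmDiff A C).ncard, ?_⟩
  unfold weight
  rw [himg, hinj.ncard_image, ← hA, ← hC]
  have : (A.ncard : ℚ) + (symmDiff A C).ncard = C.ncard + 2 * (A ∩ symmDiff A C).ncard := by
    exact_mod_cast hcard
  linarith

/-- If `cross(g∘f) = cross(f) + cross(g)`, then for every
`i ∈ {1, …, m}` the difference `w_i(S, f) + w_i(T, g) − w_i(S, g∘f)` is a
non-negative integer. -/
theorem weight_comp_defect_integer (m k : ℕ) (hm : 2 ≤ m) (hk0 : 0 < k) (hkm : k < m)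
    (S : Set ℤ) (f : ℤ → ℤ) (T : Set ℤ) (g : ℤ → ℤ)
    (hf : IsLPP m k S f) (hg : IsLPP m k T g) (hT : T = f '' S)
    (hcross : crossCount m S (g ∘ f) = crossCount m S f + crossCount m T g) :
    ∀ i : ℤ, 1 ≤ i → i ≤ (m : ℤ) →
      ∃ n : ℕ, weight i S f + weight i T g - weight i S (g ∘ f) = (n : ℚ) := by
  subst hT
  exact fun i _ _ => hf.weight_add_weight_eq hm hg i
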